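/- Under the 1D-FLP data, let C ⊆ Fin N and r ∈ C be such that p r s = 0 for every s ∈ C with s ≠ r. Then γ(C) = γ(C \ {r}). -/

import Mathlib

open Finset

/-- The weighted sum `∑_{i<j, i,j ∈ C} p i j * d i j` over pairs of indices in `C`. -/
noncomputable def pairObj {N : ℕ} (p d : Fin N → Fin N → ℝ) (C : Finset (Fin N)) : ℝ :=
  ∑ q ∈ (C ×ˢ C).filter (fun q => q.1 < q.2), p q.1 q.2 * d q.1 q.2

/-- Membership in the restricted 1D-FLP feasible set `Q₁(C)`; `Q₁ = Q₁(Finset.univ)`. -/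
def Mem1D {N : ℕ} (ℓ : Fin N → ℝ) (L : ℝ) (C : Finset (Fin N))
    (c : Fin N → ℝ) (d z : Fin N → Fin N → ℝ) : Prop :=
  (∀ i ∈ C, ∀ j ∈ C, i ≠ j → d i j = d j i) ∧
  (∀ i ∈ C, ∀ j ∈ C, i ≠ j → d i j ≥ c i - c j) ∧
  (∀ i ∈ C, ∀ j ∈ C, i ≠ j → c i + ℓ i ≤ c j - ℓ j + L * (1 - z i j)) ∧
  (∀ i ∈ C, ∀ j ∈ C, i ≠ j → z i j + z j i = 1) ∧
  (∀ i ∈ C, 0 ≤ c i ∧ c i ≤ L) ∧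
  (∀ i ∈ C, ∀ j ∈ C, i ≠ j → z i j ∈ ({0, 1} : Set ℝ))

/-- `γ(C)`: the optimal (infimum) value of the 1D-FLP restricted to the components `C`. -/
noncomputable def gamma1 {N : ℕ} (ℓ : Fin N → ℝ) (L : ℝ) (p : Fin N → Fin N → ℝ)
    (C : Finset (Fin N)) : ℝ :=
  sInf {v | ∃ c d z, Mem1D ℓ L C c d z ∧ v = pairObj p d C}

theorem Mem1D.separated {N : ℕ} {ℓ : Fin N → ℝ} {L : ℝ} {C : Finset (Fin N)}
    {c : Fin N → ℝ} {d z : Fin N → Fin N → ℝ} (h : Mem1D ℓ L C c d z)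
    {i j : Fin N} (hi : i ∈ C) (hj : j ∈ C) (hij : i ≠ j) :
    c i + ℓ i ≤ c j - ℓ j ∨ c j + ℓ j ≤ c i - ℓ i := by
  obtain ⟨-, -, hsep, hz, -, hbin⟩ := h
  have h₁ := hsep i hi j hj hij
  have h₂ := hsep j hj i hi hij.symm
  have h₃ := hz i hi j hj hij
  rcases hbin i hi j hj hij with h₀ | h₀
  · rw [h₀, zero_add] at h₃
    rw [h₃] at h₂
    right; linarith
  · rw [h₀] at h₁
    left; linarith

theorem Mem1D.abs_sub_le {N : ℕ} {ℓ : Fin N → ℝ} {L : ℝ} {C : Finset (Fin N)}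
    {c : Fin N → ℝ} {d z : Fin N → Fin N → ℝ} (h : Mem1D ℓ L C c d z)
    {i j : Fin N} (hi : i ∈ C) (hj : j ∈ C) (hij : i ≠ j) : |c i - c j| ≤ d i j := by
  have h₁ := h.1 i hi j hj hij
  have h₂ := h.2.1 i hi j hj hij
  have h₃ := h.2.1 j hj i hi hij.symm
  rw [abs_le]
  constructor <;> linarith

theorem Mem1D.mono {N : ℕ} {ℓ : Fin N → ℝ} {L : ℝ} {C D : Finset (Fin N)}
    {c : Fin N → ℝ} {d z : Fin N → Fin N → ℝ} (h : Mem1D ℓ L C c d z) (hDC : D ⊆ C) :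
    Mem1D ℓ L D c d z := by
  obtain ⟨h₁, h₂, h₃, h₄, h₅, h₆⟩ := h
  exact ⟨fun i hi j hj => h₁ i (hDC hi) j (hDC hj), fun i hi j hj => h₂ i (hDC hi) j (hDC hj),
    fun i hi j hj => h₃ i (hDC hi) j (hDC hj), fun i hi j hj => h₄ i (hDC hi) j (hDC hj),
    fun i hi => h₅ i (hDC hi), fun i hi j hj => h₆ i (hDC hi) j (hDC hj)⟩

theorem pairObj_mono {N : ℕ} {p d e : Fin N → Fin N → ℝ} {C : Finset (Fin N)}
    (hp : ∀ i j, 0 ≤ p i j) (h : ∀ i ∈ C, ∀ j ∈ C, i ≠ j → d i j ≤ e i j) :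
    pairObj p d C ≤ pairObj p e C := by
  refine Finset.sum_le_sum fun q hq => ?_
  rw [mem_filter, mem_product] at hq
  exact mul_le_mul_of_nonneg_left (h _ hq.1.1 _ hq.1.2 hq.2.ne) (hp _ _)

theorem Mem1D.pairObj_nonneg {N : ℕ} {ℓ : Fin N → ℝ} {L : ℝ} {C : Finset (Fin N)}
    {c : Fin N → ℝ} {d z p : Fin N → Fin N → ℝ} (h : Mem1D ℓ L C c d z)
    (hp : ∀ i j, 0 ≤ p i j) : 0 ≤ pairObj p d C := by
  refine Finset.sum_nonneg fun q hq => ?_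
  rw [mem_filter, mem_product] at hq
  exact mul_nonneg (hp _ _) ((abs_nonneg _).trans (h.abs_sub_le hq.1.1 hq.1.2 hq.2.ne))

theorem pairObj_erase {N : ℕ} {p : Fin N → Fin N → ℝ} (d : Fin N → Fin N → ℝ)
    {C : Finset (Fin N)} {r : Fin N} (hpsym : ∀ i j, p i j = p j i)
    (hzero : ∀ s ∈ C, s ≠ r → p r s = 0) : pairObj p d (C.erase r) = pairObj p d C := by
  refine Finset.sum_subset (fun q hq => ?_) fun q hq hq' => ?_
  · simp only [mem_filter, mem_product, mem_erase] at hq ⊢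
    exact ⟨⟨hq.1.1.2, hq.1.2.2⟩, hq.2⟩
  · simp only [mem_filter, mem_product, mem_erase] at hq hq'
    by_cases h₁ : q.1 = r
    · rw [h₁, hzero q.2 hq.1.2 (h₁ ▸ hq.2.ne'), zero_mul]
    · by_cases h₂ : q.2 = r
      · rw [hpsym, h₂, hzero q.1 hq.1.1 h₁, zero_mul]
      · exact absurd ⟨⟨⟨h₁, hq.1.1⟩, h₂, hq.1.2⟩, hq.2⟩ hq'

/-- Pairwise disjoint intervals contained in `[a, b]` have total length at most `b - a`. -/
theorem two_mul_sum_halfLength_le {ι : Type*} [DecidableEq ι] {ℓ c : ι → ℝ} (hℓ : ∀ i, 0 < ℓ i)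
    {a : ℝ} (S : Finset ι) :
    (∀ i ∈ S, ∀ j ∈ S, i ≠ j → c i + ℓ i ≤ c j - ℓ j ∨ c j + ℓ j ≤ c i - ℓ i) →
    ∀ b, a ≤ b → (∀ k ∈ S, a ≤ c k - ℓ k ∧ c k + ℓ k ≤ b) → 2 * ∑ k ∈ S, ℓ k ≤ b - a := by
  induction S using Finset.induction_on_max_value c with
  | empty => intro _ b hab _; simpa using hab
  | insert m S hm hmax ih =>
    intro hsep b hab hS
    have hm' := hS m (mem_insert_self m S)
    have := ih (fun i hi j hj => hsep i (mem_insert_of_mem hi) j (mem_insert_of_mem hj))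
      (c m - ℓ m) hm'.1 fun k hk => ⟨(hS k (mem_insert_of_mem hk)).1, by
        have hkm : k ≠ m := fun h => hm (h ▸ hk)
        rcases hsep k (mem_insert_of_mem hk) m (mem_insert_self m S) hkm with h | h
        · exact h
        · linarith [hmax k hk, hℓ k, hℓ m]⟩
    rw [sum_insert hm]
    linarith [hm'.2]

/-- The centers obtained by packing the components of `C` from `0` in increasing order of `f`. -/
noncomputable def packedCenter {N : ℕ} (ℓ : Fin N → ℝ) (C : Finset (Fin N)) (f : Fin N → ℝ)
    (i : Fin N) : ℝ :=
  ℓ i + 2 * ∑ k ∈ C.filter (fun k => f k < f i), ℓ k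

theorem packedCenter_separated {N : ℕ} {ℓ : Fin N → ℝ} (hℓ : ∀ i, 0 < ℓ i)
    {C : Finset (Fin N)} {f : Fin N → ℝ} {i j : Fin N} (hi : i ∈ C) (hij : f i < f j) :
    packedCenter ℓ C f i + ℓ i ≤ packedCenter ℓ C f j - ℓ j := by
  have hn : i ∉ C.filter (fun k => f k < f i) := by simp
  have : ∑ k ∈ insert i (C.filter (fun k => f k < f i)), ℓ k ≤
      ∑ k ∈ C.filter (fun k => f k < f j), ℓ k := by
    refine sum_le_sum_of_subset_of_nonneg (fun k hk => ?_) fun k _ _ => (hℓ k).le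
    rw [mem_insert, mem_filter] at hk
    rw [mem_filter]
    rcases hk with rfl | hk
    · exact ⟨hi, hij⟩
    · exact ⟨hk.1, hk.2.trans hij⟩
  rw [sum_insert hn] at this
  unfold packedCenter
  linarith

theorem packedCenter_sub_nonneg {N : ℕ} {ℓ : Fin N → ℝ} (hℓ : ∀ i, 0 < ℓ i)
    (C : Finset (Fin N)) (f : Fin N → ℝ) (i : Fin N) : 0 ≤ packedCenter ℓ C f i - ℓ i := by
  have : 0 ≤ ∑ k ∈ C.filter (fun k => f k < f i), ℓ k := sum_nonneg fun k _ => (hℓ k).le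
  unfold packedCenter
  linarith

theorem packedCenter_add_le {N : ℕ} {ℓ : Fin N → ℝ} (hℓ : ∀ i, 0 < ℓ i)
    (C : Finset (Fin N)) (f : Fin N → ℝ) (i : Fin N) :
    packedCenter ℓ C f i + ℓ i ≤ 2 * ∑ k, ℓ k := by
  have hn : i ∉ C.filter (fun k => f k < f i) := by simp
  have : ∑ k ∈ insert i (C.filter (fun k => f k < f i)), ℓ k ≤ ∑ k, ℓ k :=
    sum_le_sum_of_subset_of_nonneg (subset_univ _) fun k _ _ => (hℓ k).le
  rw [sum_insert hn] at this
  unfold packedCenter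
  linarith

theorem mem1D_packedCenter {N : ℕ} {ℓ : Fin N → ℝ} (hℓ : ∀ i, 0 < ℓ i) {L : ℝ}
    (hL : L ≥ 2 * ∑ i, ℓ i) {C : Finset (Fin N)} {f : Fin N → ℝ} (hf : Set.InjOn f C) :
    Mem1D ℓ L C (packedCenter ℓ C f) (fun i j => |packedCenter ℓ C f i - packedCenter ℓ C f j|)
      (fun i j => if f i < f j then 1 else 0) := by
  refine ⟨fun i _ j _ _ => abs_sub_comm _ _, fun i _ j _ _ => le_abs_self _,
    fun i hi j hj hij => ?_, fun i hi j hj hij => ?_, fun i hi => ?_, fun i hi j hj hij => ?_⟩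
  · dsimp only
    split_ifs with h
    · linarith [packedCenter_separated hℓ hi h]
    · linarith [packedCenter_sub_nonneg hℓ C f j, packedCenter_add_le hℓ C f i]
  · rcases lt_or_gt_of_ne (fun h => hij (hf hi hj h)) with h | h
    · simp [h, h.le]
    · simp [h, h.le]
  · constructor <;>
      linarith [packedCenter_sub_nonneg hℓ C f i, packedCenter_add_le hℓ C f i, hℓ i]
  · dsimp only
    split_ifs <;> simp

/-- Packing does not increase the distance between two components when everything placed between
them is already separated with respect to `f`. -/
theorem packedCenter_sub_le {N : ℕ} {ℓ : Fin N → ℝ} (hℓ : ∀ i, 0 < ℓ i)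
    {C D : Finset (Fin N)} {f : Fin N → ℝ}
    (hsep : ∀ i ∈ D, ∀ j ∈ D, i ≠ j → f i + ℓ i ≤ f j - ℓ j ∨ f j + ℓ j ≤ f i - ℓ i)
    {i j : Fin N} (hi : i ∈ D) (hj : j ∈ D) (hij : f i < f j)
    (hD : ∀ k ∈ C, f k < f j → k ∈ D) :
    packedCenter ℓ C f j - packedCenter ℓ C f i ≤ f j - f i := by
  have hlt : ∀ k ∈ D, ∀ l ∈ D, f k < f l → f k + ℓ k ≤ f l - ℓ l := by
    intro k hk l hl hkl
    rcases hsep k hk l hl (fun h => hkl.ne (h ▸ rfl)) with h | h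
    · exact h
    · linarith [hℓ k, hℓ l]
  set A := C.filter (fun k => f k < f i)
  set B := C.filter (fun k => f k < f j)
  have hAB : A ⊆ B := fun k hk => by
    rw [mem_filter] at hk ⊢
    exact ⟨hk.1, hk.2.trans hij⟩
  have hmem : ∀ k ∈ B \ A, k ∈ D ∧ f i ≤ f k ∧ f k < f j := by
    intro k hk
    simp only [A, B, mem_sdiff, mem_filter, not_and, not_lt] at hk
    exact ⟨hD k hk.1.1 hk.1.2, hk.2 hk.1.1, hk.1.2⟩
  have hsum := sum_sdiff (f := ℓ) hAB
  have := two_mul_sum_halfLength_le (c := f) hℓ (a := f i - ℓ i) (B \ A)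
    (fun k hk l hl => hsep k (hmem k hk).1 l (hmem l hl).1) (f j - ℓ j)
    (by linarith [hlt i hi j hj hij, hℓ i]) fun k hk => by
      obtain ⟨hkD, hik, hkj⟩ := hmem k hk
      refine ⟨?_, hlt k hkD j hj hkj⟩
      by_cases h : i = k
      · rw [h]
      · rcases hsep i hi k hkD h with h | h <;> linarith [hℓ i, hℓ k]
  simp only [packedCenter]
  linarith

/-- A feasible layout of `C.erase r` can be packed, with `r` appended at the end, into a feasible
layout of `C` in which no distance within `C.erase r` has grown. -/
theorem Mem1D.exists_of_erase {N : ℕ} {ℓ : Fin N → ℝ} (hℓ : ∀ i, 0 < ℓ i) {L : ℝ}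
    (hL : L ≥ 2 * ∑ i, ℓ i) {C : Finset (Fin N)} {r : Fin N}
    {c : Fin N → ℝ} {d z : Fin N → Fin N → ℝ} (h : Mem1D ℓ L (C.erase r) c d z) :
    ∃ c' d' z', Mem1D ℓ L C c' d' z' ∧
      ∀ i ∈ C.erase r, ∀ j ∈ C.erase r, i ≠ j → d' i j ≤ d i j := by
  set f := Function.update c r (L + 1) with hfdef
  have hfr : f r = L + 1 := Function.update_self ..
  have hfc : ∀ i ∈ C.erase r, f i = c i := fun i hi =>
    Function.update_of_ne (ne_of_mem_erase hi) ..
  have hfL : ∀ i ∈ C.erase r, f i ≤ L := fun i hi => hfc i hi ▸ (h.2.2.2.2.1 i hi).2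
  have hsep : ∀ i ∈ C.erase r, ∀ j ∈ C.erase r, i ≠ j →
      f i + ℓ i ≤ f j - ℓ j ∨ f j + ℓ j ≤ f i - ℓ i := by
    intro i hi j hj hij
    rw [hfc i hi, hfc j hj]
    exact h.separated hi hj hij
  have hne : ∀ i ∈ C.erase r, ∀ j ∈ C.erase r, i ≠ j → f i ≠ f j := by
    intro i hi j hj hij heq
    rcases hsep i hi j hj hij with h | h <;> linarith [hℓ i, hℓ j]
  have hinj : Set.InjOn f C := by
    intro i hi j hj heq
    by_contra hij
    by_cases hir : i = r
    · subst hir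
      linarith [hfL j (mem_erase.2 ⟨Ne.symm hij, hj⟩)]
    · have hi' := mem_erase.2 ⟨hir, hi⟩
      by_cases hjr : j = r
      · subst hjr
        linarith [hfL i hi']
      · exact hne i hi' j (mem_erase.2 ⟨hjr, hj⟩) hij heq
  have hD : ∀ j ∈ C.erase r, ∀ k ∈ C, f k < f j → k ∈ C.erase r := by
    intro j hj k hk hkj
    refine mem_erase.2 ⟨fun hkr => ?_, hk⟩
    rw [hkr] at hkj
    linarith [hfL j hj]
  refine ⟨_, _, _, mem1D_packedCenter hℓ hL hinj, fun i hi j hj hij => ?_⟩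
  refine le_trans ?_ (h.abs_sub_le hi hj hij)
  rw [← hfc i hi, ← hfc j hj]
  rcases lt_or_gt_of_ne (hne i hi j hj hij) with hlt | hlt
  · have h₁ := packedCenter_sub_le hℓ hsep hi hj hlt (hD j hj)
    have h₂ := packedCenter_separated hℓ (mem_of_mem_erase hi) hlt
    rw [abs_of_neg (sub_neg.2 hlt), abs_of_neg (by linarith [hℓ i, hℓ j])]
    linarith
  · have h₁ := packedCenter_sub_le hℓ hsep hj hi hlt (hD i hi)
    have h₂ := packedCenter_separated hℓ (mem_of_mem_erase hj) hlt
    rw [abs_of_pos (sub_pos.2 hlt), abs_of_pos (by linarith [hℓ i, hℓ j])]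
    linarith

/-- a component with zero weight to all other components of `C` can be removed
without changing the partial bound: `γ(C) = γ(C \ {r})`. -/
theorem gamma_prune_zero_weight {N : ℕ} (hN : 2 ≤ N)
    (ℓ : Fin N → ℝ) (hℓ : ∀ i, 0 < ℓ i)
    (p : Fin N → Fin N → ℝ) (hpsym : ∀ i j, p i j = p j i)
    (hpnn : ∀ i j, 0 ≤ p i j) (hpdiag : ∀ i, p i i = 0)
    (L : ℝ) (hL : L ≥ 2 * ∑ i, ℓ i)
    (C : Finset (Fin N)) (r : Fin N) (hr : r ∈ C)
    (hzero : ∀ s ∈ C, s ≠ r → p r s = 0) :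
    gamma1 ℓ L p C = gamma1 ℓ L p (C.erase r) := by
  unfold gamma1
  set S := {v | ∃ c d z, Mem1D ℓ L C c d z ∧ v = pairObj p d C}
  set T := {v | ∃ c d z, Mem1D ℓ L (C.erase r) c d z ∧ v = pairObj p d (C.erase r)}
  have hST : S ⊆ T := by
    rintro v ⟨c, d, z, h, rfl⟩
    exact ⟨c, d, z, h.mono (erase_subset r C), (pairObj_erase d hpsym hzero).symm⟩
  have hTS : ∀ v ∈ T, ∃ w ∈ S, w ≤ v := by
    rintro v ⟨c, d, z, h, rfl⟩
    obtain ⟨c', d', z', h', hle⟩ := h.exists_of_erase hℓ hL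
    refine ⟨_, ⟨c', d', z', h', rfl⟩, ?_⟩
    rw [← pairObj_erase d' hpsym hzero]
    exact pairObj_mono hpnn hle
  have hT : BddBelow T := ⟨0, by
    rintro v ⟨c, d, z, h, rfl⟩
    exact h.pairObj_nonneg hpnn⟩
  rcases T.eq_empty_or_nonempty with hempty | hnonempty
  · rw [hempty] at hST ⊢
    rw [Set.subset_empty_iff.1 hST]
  · refine le_antisymm (le_csInf hnonempty fun v hv => ?_) ?_
    · obtain ⟨w, hw, hwv⟩ := hTS v hv
      exact (csInf_le (hT.mono hST) hw).trans hwv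
    · obtain ⟨v, hv⟩ := hnonempty
      obtain ⟨w, hw, -⟩ := hTS v hv
      exact csInf_le_csInf hT ⟨w, hw⟩ hST
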